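/- Let Γ be a countable amenable group containing an element b of infinite order, and Λ ⊆ Γ a set with positive upper density with respect to a left Følner sequence. Then for every k, Λ contains a left arithmetic progression of length k, i.e., a set {b^{jn} a : j = 1, ..., k} of k distinct elements for some a ∈ Γ and n > 0. -/

import Mathlib

open Filter Topology

namespace DensityHalesJewett

open Combinatorics Set

noncomputable section

/-! ### Averages over finite types -/

/-- The average of a real function on a finite type. -/
def mean {X : Type*} [Finite X] (f : X → ℝ) : ℝ :=
  letI := Fintype.ofFinite X
  (∑ x, f x) / Fintype.card X

/-- The density of a set in a finite type. -/
def dens {X : Type*} [Finite X] (A : Set X) : ℝ := mean (A.indicator 1)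

lemma indicator_one_nonneg {X : Type*} (A : Set X) (x : X) : (0 : ℝ) ≤ A.indicator 1 x :=
  indicator_nonneg (fun _ _ ↦ zero_le_one) x

lemma indicator_one_le_one {X : Type*} (A : Set X) (x : X) : A.indicator (1 : X → ℝ) x ≤ 1 :=
  indicator_le_self' (fun _ _ ↦ zero_le_one) x

section Mean

variable {X Y Z : Type*} [Finite X] [Finite Y] [Finite Z]

lemma mean_eq_sum_div [h : Fintype X] (f : X → ℝ) : mean f = (∑ x, f x) / Fintype.card X := by
  rw [mean, Subsingleton.elim (Fintype.ofFinite X) h]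

lemma mean_add (f g : X → ℝ) : mean (fun x ↦ f x + g x) = mean f + mean g := by
  simp [mean, Finset.sum_add_distrib, add_div]

lemma mean_sub (f g : X → ℝ) : mean (fun x ↦ f x - g x) = mean f - mean g := by
  simp [mean, sub_div]

lemma mean_const_mul (c : ℝ) (f : X → ℝ) : mean (fun x ↦ c * f x) = c * mean f := by
  simp [mean, ← Finset.mul_sum, mul_div_assoc]

lemma mean_const [Nonempty X] (c : ℝ) : mean (fun _ : X ↦ c) = c := by
  cases nonempty_fintype X
  simp [mean_eq_sum_div]

lemma mean_mono {f g : X → ℝ} (h : ∀ x, f x ≤ g x) : mean f ≤ mean g := by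
  unfold mean
  gcongr with x
  exact h x

lemma mean_nonneg {f : X → ℝ} (h : ∀ x, 0 ≤ f x) : 0 ≤ mean f :=
  div_nonneg (Finset.sum_nonneg fun x _ ↦ h x) (Nat.cast_nonneg _)

lemma mean_le [Nonempty X] {f : X → ℝ} {c : ℝ} (h : ∀ x, f x ≤ c) : mean f ≤ c :=
  (mean_mono h).trans_eq (mean_const c)

lemma le_mean [Nonempty X] {f : X → ℝ} {c : ℝ} (h : ∀ x, c ≤ f x) : c ≤ mean f :=
  (mean_const c).symm.trans_le (mean_mono h)

lemma mean_comp_equiv (e : X ≃ Y) (f : Y → ℝ) : mean (fun x ↦ f (e x)) = mean f := by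
  cases nonempty_fintype X
  cases nonempty_fintype Y
  rw [mean_eq_sum_div, mean_eq_sum_div, Fintype.card_congr e, e.sum_comp]

lemma mean_prod (f : X × Y → ℝ) : mean f = mean fun x ↦ mean fun y ↦ f (x, y) := by
  cases nonempty_fintype X
  cases nonempty_fintype Y
  simp only [mean_eq_sum_div, Fintype.sum_prod_type, Fintype.card_prod, ← Finset.sum_div, div_div]
  push_cast
  rw [mul_comm]

lemma mean_comm (f : X → Y → ℝ) :
    (mean fun x ↦ mean fun y ↦ f x y) = mean fun y ↦ mean fun x ↦ f x y := by
  rw [← mean_prod fun p : X × Y ↦ f p.1 p.2, ← mean_prod fun p : Y × X ↦ f p.2 p.1,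
    ← mean_comp_equiv (Equiv.prodComm X Y)]
  rfl

lemma mean_finset_sum {L : Type*} (s : Finset L) (f : L → X → ℝ) :
    (mean fun x ↦ ∑ l ∈ s, f l x) = ∑ l ∈ s, mean (f l) := by
  simp only [mean, ← Finset.sum_div]
  rw [Finset.sum_comm]

lemma le_card_mul_mean {f : X → ℝ} (h : ∀ x, 0 ≤ f x) (x : X) : f x ≤ Nat.card X * mean f := by
  cases nonempty_fintype X
  have : Nonempty X := ⟨x⟩
  rw [mean_eq_sum_div, Nat.card_eq_fintype_card, mul_div_cancel₀ _ (by simp)]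
  exact Finset.single_le_sum (fun i _ ↦ h i) (Finset.mem_univ x)

lemma mean_range_indicator {V : Z → X} (hV : V.Injective) (h : X → ℝ) :
    mean ((range V).indicator h) = Nat.card Z / Nat.card X * mean fun z ↦ h (V z) := by
  classical
  cases nonempty_fintype X
  cases nonempty_fintype Z
  rw [mean_eq_sum_div, mean_eq_sum_div, Nat.card_eq_fintype_card, Nat.card_eq_fintype_card]
  have : ∑ x, (range V).indicator h x = ∑ z, h (V z) := by
    rw [← Finset.sum_image (f := h) (s := Finset.univ) (fun a _ b _ hab ↦ hV hab)]
    rw [Finset.sum_indicator_eq_sum_filter]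
    congr 1
    ext x
    simp
  rw [this]
  rcases isEmpty_or_nonempty Z
  · simp
  · have : (Fintype.card Z : ℝ) ≠ 0 := by simp
    field_simp

lemma exists_le_of_le_mean {f : X → ℝ} {c : ℝ} (hc : 0 < c) (h : c ≤ mean f) : ∃ x, c ≤ f x := by
  rcases isEmpty_or_nonempty X
  · simp [mean] at h
    linarith
  by_contra! H
  cases nonempty_fintype X
  rw [mean_eq_sum_div, le_div_iff₀ (by simp [Fintype.card_pos])] at h
  have := Finset.sum_lt_sum_of_nonempty (s := Finset.univ) Finset.univ_nonempty
    fun i (_ : i ∈ Finset.univ) ↦ H i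
  simp at this
  linarith

lemma dens_le_one (A : Set X) : dens A ≤ 1 := by
  rcases isEmpty_or_nonempty X
  · simp [dens, mean]
  · exact mean_le (indicator_one_le_one A)

/-- If every fibre of density at least `η / 2` contains a member of a finite family, then some
member of the family is contained in many fibres. -/
lemma exists_popular {L : Type*} [Finite L] [Nonempty Y] {η : ℝ} (hη : 0 < η)
    (R : L → Set X) (P : Y → Set X) (h : ∀ y, η / 2 ≤ dens (P y) → ∃ l, R l ⊆ P y)
    (hd : η ≤ mean fun y ↦ dens (P y)) :
    ∃ l, η / 2 / (Nat.card L + 1) ≤ dens {y | R l ⊆ P y} := by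
  cases nonempty_fintype L
  have key : (mean fun y ↦ dens (P y)) ≤
      mean fun y ↦ η / 2 + ∑ l, {y | R l ⊆ P y}.indicator (1 : Y → ℝ) y := by
    refine mean_mono fun y ↦ ?_
    have hs : ∀ l, 0 ≤ {y | R l ⊆ P y}.indicator (1 : Y → ℝ) y :=
      fun l ↦ indicator_one_nonneg _ _
    by_cases hy : η / 2 ≤ dens (P y)
    · obtain ⟨l, hl⟩ := h y hy
      have h1 := Finset.single_le_sum (fun i _ ↦ hs i) (Finset.mem_univ l)
      rw [indicator_of_mem (show y ∈ {y | R l ⊆ P y} from hl)] at h1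
      have := dens_le_one (P y)
      simp only [Pi.one_apply] at h1
      linarith
    · have := Finset.sum_nonneg fun i (_ : i ∈ Finset.univ) ↦ hs i
      linarith
  rw [mean_add, mean_const, mean_finset_sum] at key
  have hsum : η / 2 ≤ ∑ l, dens {y | R l ⊆ P y} := by
    unfold dens at *
    linarith
  have hL : Nonempty L := by
    by_contra hL
    rw [not_nonempty_iff] at hL
    simp at hsum
    linarith
  have hc : (0 : ℝ) < Fintype.card L := by exact_mod_cast Fintype.card_pos
  obtain ⟨l, -, hl⟩ := Finset.exists_le_of_sum_le (s := Finset.univ)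
    (f := fun _ : L ↦ η / 2 / Fintype.card L) Finset.univ_nonempty
    (show _ ≤ ∑ l, dens {y | R l ⊆ P y} by simpa [mul_div_cancel₀ _ hc.ne'] using hsum)
  refine ⟨l, ?_⟩
  refine le_trans ?_ hl
  rw [Nat.card_eq_fintype_card]
  gcongr
  linarith

end Mean

section Cube

variable {α ι κ : Type*} [Finite α] [Finite ι] [Finite κ]

lemma mean_cube_sum (f : (ι ⊕ κ → α) → ℝ) :
    mean f = mean fun x : ι → α ↦ mean fun y : κ → α ↦ f (Sum.elim x y) := by
  rw [← mean_prod fun p : (ι → α) × (κ → α) ↦ f (Sum.elim p.1 p.2),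
    ← mean_comp_equiv (Equiv.sumArrowEquivProdArrow ι κ α).symm]
  rfl

lemma mean_cube_sum' (f : (ι ⊕ κ → α) → ℝ) :
    mean f = mean fun y : κ → α ↦ mean fun x : ι → α ↦ f (Sum.elim x y) := by
  rw [mean_cube_sum, mean_comm]

end Cube

/-! ### Operations on combinatorial subspaces -/

section Subspaces

variable {α β η ζ ι κ : Type*}

/-- A subspace of the second factor, placed over a point of the first factor. -/
def fiberRight (x : ι → α) (V : Subspace η α κ) : Subspace η α (ι ⊕ κ) where
  idxFun := Sum.elim (fun i ↦ .inl (x i)) V.idxFun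
  proper e := let ⟨i, hi⟩ := V.proper e; ⟨.inr i, hi⟩

lemma fiberRight_apply (x : ι → α) (V : Subspace η α κ) (z : η → α) :
    fiberRight x V z = Sum.elim x (V z) := by
  ext i; cases i <;> rfl

/-- A subspace of the first factor, placed over a point of the second factor. -/
def fiberLeft (V : Subspace η α ι) (y : κ → α) : Subspace η α (ι ⊕ κ) where
  idxFun := Sum.elim V.idxFun (fun i ↦ .inl (y i))
  proper e := let ⟨i, hi⟩ := V.proper e; ⟨.inl i, hi⟩

lemma fiberLeft_apply (V : Subspace η α ι) (y : κ → α) (z : η → α) :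
    fiberLeft V y z = Sum.elim (V z) y := by
  ext i; cases i <;> rfl

/-- The product of two subspaces. -/
def prod (V : Subspace η α ι) (U : Subspace ζ α κ) : Subspace (η ⊕ ζ) α (ι ⊕ κ) where
  idxFun := Sum.elim (fun i ↦ (V.idxFun i).map id .inl) (fun i ↦ (U.idxFun i).map id .inr)
  proper e := by
    rcases e with e | e
    · obtain ⟨i, hi⟩ := V.proper e
      exact ⟨.inl i, by simp [hi]⟩
    · obtain ⟨i, hi⟩ := U.proper e
      exact ⟨.inr i, by simp [hi]⟩

lemma prod_apply (V : Subspace η α ι) (U : Subspace ζ α κ) (z : η ⊕ ζ → α) :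
    prod V U z = Sum.elim (V (z ∘ .inl)) (U (z ∘ .inr)) := by
  ext i
  rcases i with i | i
  · rcases h : V.idxFun i <;> simp [prod, Subspace.coe_apply, h]
  · rcases h : U.idxFun i <;> simp [prod, Subspace.coe_apply, h]

/-- A subspace of a subspace. -/
def comp (V : Subspace η α ι) (U : Subspace ζ α η) : Subspace ζ α ι where
  idxFun i := (V.idxFun i).elim .inl U.idxFun
  proper e := by
    obtain ⟨j, hj⟩ := U.proper e
    obtain ⟨i, hi⟩ := V.proper j
    exact ⟨i, by simp [hi, hj]⟩

lemma comp_apply (V : Subspace η α ι) (U : Subspace ζ α η) (z : ζ → α) :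
    comp V U z = V (U z) := by
  ext i
  rcases h : V.idxFun i <;> simp [comp, Subspace.coe_apply, h]

lemma default_apply (z : ι → α) : (default : Subspace ι α ι) z = z := rfl

/-- A subspace over `β`, considered over the alphabet `Option β`. -/
def lift (V : Subspace η β ι) : Subspace η (Option β) ι where
  idxFun i := (V.idxFun i).map some id
  proper e := let ⟨i, hi⟩ := V.proper e; ⟨i, by simp [hi]⟩

lemma lift_some (V : Subspace η β ι) (z : η → β) :
    lift V (fun e ↦ some (z e)) = fun i ↦ some (V z i) := by
  ext i
  rcases h : V.idxFun i <;> simp [lift, Subspace.coe_apply, h]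

lemma subspace_injective (V : Subspace η α ι) : Function.Injective V := by
  intro x y h
  ext e
  obtain ⟨i, hi⟩ := V.proper e
  simpa [Subspace.apply_inr hi] using congrFun h i

instance [Finite η] [Finite α] [Finite ι] : Finite (Subspace η α ι) :=
  Finite.of_injective Subspace.idxFun fun _ _ ↦ Subspace.ext

/-- Replace the letter `none` by `r`. -/
def subst (r : β) (x : ι → Option β) : ι → Option β := fun i ↦ some ((x i).getD r)

lemma subst_subst (r s : β) (x : ι → Option β) : subst r (subst s x) = subst s x := by
  ext i; simp [subst]

lemma subst_sum_elim (r : β) (x : ι → Option β) (y : κ → Option β) :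
    subst r (Sum.elim x y) = Sum.elim (subst r x) (subst r y) := by
  ext i; cases i <;> rfl

lemma subst_apply_subst (r : β) (V : Subspace η (Option β) ι) (z : η → Option β) :
    subst r (V (subst r z)) = subst r (V z) := by
  ext i
  rcases h : V.idxFun i <;> simp [subst, Subspace.coe_apply, h]

lemma subst_lift (r : β) (V : Subspace η β ι) (z : η → Option β) :
    subst r (lift V z) = lift V (subst r z) := by
  ext i
  rcases h : V.idxFun i <;> simp [lift, subst, Subspace.coe_apply, h]

/-- The set `D` does not distinguish the letter `none` from the letter `r`. -/
def Insensitive (r : β) (D : Set (ι → Option β)) : Prop := ∀ x, subst r x ∈ D ↔ x ∈ D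

lemma Insensitive.compl {r : β} {D : Set (ι → Option β)} (h : Insensitive r D) :
    Insensitive r Dᶜ := fun x ↦ not_congr (h x)

lemma Insensitive.preimage {r : β} {D : Set (ι → Option β)} (h : Insensitive r D)
    (V : Subspace η (Option β) ι) : Insensitive r (V ⁻¹' D) := fun z ↦ by
  rw [mem_preimage, mem_preimage, ← h, subst_apply_subst, h]

lemma Insensitive.sum_elim_left {r : β} {D : Set (ι ⊕ κ → Option β)} (h : Insensitive r D)
    (x : ι → Option β) (y : κ → Option β) : Sum.elim (subst r x) y ∈ D ↔ Sum.elim x y ∈ D := by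
  rw [← h, subst_sum_elim, subst_subst, ← subst_sum_elim, h]

lemma Insensitive.sum_elim_right {r : β} {D : Set (ι ⊕ κ → Option β)} (h : Insensitive r D)
    (x : ι → Option β) (y : κ → Option β) : Sum.elim x (subst r y) ∈ D ↔ Sum.elim x y ∈ D := by
  rw [← h, subst_sum_elim, subst_subst, ← subst_sum_elim, h]

end Subspaces

/-! ### Multidimensional density theorem -/

/-- The density Hales-Jewett theorem for the alphabet `β`. -/
def DensityHJ (β : Type) [Finite β] : Prop :=
  ∀ δ : ℝ, 0 < δ → ∃ (ι : Type) (_ : Finite ι), ∀ A : Set (ι → β), δ ≤ dens A →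
    ∃ V : Subspace Unit β ι, ∀ x, V x ∈ A

lemma exists_mem_of_dens_pos {X : Type*} [Finite X] {A : Set X} {δ : ℝ} (hδ : 0 < δ)
    (h : δ ≤ dens A) : ∃ x, x ∈ A := by
  obtain ⟨x, hx⟩ := exists_le_of_le_mean hδ h
  exact ⟨x, mem_of_indicator_ne_zero (hδ.trans_le hx).ne'⟩

lemma DensityHJ.exists_subspace {β : Type} [Finite β] [Nonempty β] (h : DensityHJ β) (d : ℕ) :
    ∀ δ : ℝ, 0 < δ → ∃ (ι : Type) (_ : Finite ι), ∀ A : Set (ι → β), δ ≤ dens A →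
      ∃ V : Subspace (Fin d) β ι, ∀ x, V x ∈ A := by
  induction d with
  | zero =>
    refine fun δ hδ ↦ ⟨Empty, inferInstance, fun A hA ↦ ?_⟩
    obtain ⟨x, hx⟩ := exists_mem_of_dens_pos hδ hA
    exact ⟨⟨Empty.elim, fun e ↦ e.elim0⟩, fun z ↦ by convert hx⟩
  | succ d ih =>
    intro δ hδ
    obtain ⟨ι, _, hι⟩ := h (δ / 2) (by positivity)
    obtain ⟨κ, _, hκ⟩ := ih (δ / 2 / (Nat.card (Subspace Unit β ι) + 1)) (by positivity)
    refine ⟨ι ⊕ κ, inferInstance, fun A hA ↦ ?_⟩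
    have hA' : δ ≤ mean fun y : κ → β ↦ dens {x : ι → β | Sum.elim x y ∈ A} := by
      rw [dens, mean_cube_sum'] at hA
      exact hA
    obtain ⟨l, hl⟩ := exists_popular hδ (fun l : Subspace Unit β ι ↦ range l) _
      (fun y hy ↦ by simpa [range_subset_iff] using hι _ hy) hA'
    obtain ⟨V, hV⟩ := hκ _ hl
    let e : Unit ⊕ Fin d ≃ Fin (d + 1) := Fintype.equivOfCardEq (by simp [add_comm])
    refine ⟨(prod l V).reindex e (Equiv.refl _) (Equiv.refl _), fun x ↦ ?_⟩
    have := hV ((x ∘ e) ∘ Sum.inr) (mem_range_self ((x ∘ e) ∘ Sum.inl))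
    rw [mem_ofPred_eq, ← prod_apply] at this
    convert this using 1
    ext i
    simp

lemma DensityHJ.exists_subspace_of_le_card {β : Type} [Finite β] [Nonempty β] (h : DensityHJ β)
    (d : ℕ) {δ : ℝ} (hδ : 0 < δ) :
    ∃ N : ℕ, ∀ (κ : Type) [Finite κ], N ≤ Nat.card κ → ∀ A : Set (κ → β), δ ≤ dens A →
      ∃ V : Subspace (Fin d) β κ, ∀ x, V x ∈ A := by
  obtain ⟨ι, _, hι⟩ := h.exists_subspace d δ hδ
  refine ⟨Nat.card ι, fun κ _ hκ A hA ↦ ?_⟩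
  cases nonempty_fintype ι
  cases nonempty_fintype κ
  rw [Nat.card_eq_fintype_card, Nat.card_eq_fintype_card] at hκ
  let e : ι ⊕ Fin (Fintype.card κ - Fintype.card ι) ≃ κ :=
    Fintype.equivOfCardEq (by simp [hκ])
  rw [dens, ← mean_comp_equiv (e.arrowCongr (Equiv.refl β)), mean_cube_sum'] at hA
  obtain ⟨y, hy⟩ := exists_le_of_le_mean hδ hA
  obtain ⟨V, hV⟩ := hι {x | e.arrowCongr (Equiv.refl β) (Sum.elim x y) ∈ A} hy
  refine ⟨(fiberLeft V y).reindex (Equiv.refl _) (Equiv.refl _) e, fun x ↦ ?_⟩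
  have := hV x
  rw [mem_ofPred_eq, ← fiberLeft_apply] at this
  convert this using 1
  ext i
  simp

/-! ### Dense insensitive sets contain subspaces -/

lemma exists_dens_small_support (β : Type) [Finite β] [Nonempty β] (N : ℕ) {η : ℝ} (hη : 0 < η) :
    ∃ n : ℕ, dens {x : Fin n → Option β | Nat.card {i | x i ≠ none} < N} ≤ η := by
  classical
  cases nonempty_fintype β
  obtain ⟨k, hk⟩ : ∃ k : ℝ, k = Fintype.card β := ⟨_, rfl⟩
  have hk0 : 0 < k := by simp [hk, Fintype.card_pos]
  have hlim := (tendsto_pow_atTop_nhds_zero_of_lt_one (r := (1 + k / 2) / (1 + k)) (by positivity)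
    (by rw [div_lt_one (by positivity)]; linarith)).const_mul ((2 : ℝ) ^ N)
  rw [mul_zero] at hlim
  obtain ⟨n, hn⟩ := (hlim.eventually_le_const hη).exists
  refine ⟨n, le_trans ?_ hn⟩
  let c : Option β → ℝ := fun a ↦ if a = none then 1 else 1 / 2
  have hprod : ∀ x : Fin n → Option β, ∏ i, c (x i) = (1 / 2) ^ Nat.card {i | x i ≠ none} := by
    intro x
    have h2 : Nat.card {i | x i ≠ none} = (Finset.univ.filter fun i ↦ ¬ x i = none).card := by
      rw [Nat.card_eq_fintype_card]
      exact Fintype.card_subtype _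
    rw [h2, Finset.prod_ite]
    simp
  have hle : ∀ x : Fin n → Option β,
      {x : Fin n → Option β | Nat.card {i | x i ≠ none} < N}.indicator 1 x ≤
        2 ^ N * ∏ i, c (x i) := by
    intro x
    rw [hprod]
    by_cases hx : Nat.card {i | x i ≠ none} < N
    · rw [indicator_of_mem (by exact hx)]
      have : (1 / 2 : ℝ) ^ N ≤ (1 / 2) ^ Nat.card {i | x i ≠ none} :=
        pow_le_pow_of_le_one (by norm_num) (by norm_num) hx.le
      calc (1 : ℝ) = 2 ^ N * (1 / 2) ^ N := by rw [← mul_pow]; norm_num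
        _ ≤ _ := mul_le_mul_of_nonneg_left this (by positivity)
    · rw [indicator_of_notMem (by exact hx)]
      positivity
  refine (mean_mono hle).trans_eq ?_
  rw [mean_const_mul, mean_eq_sum_div, ← Fintype.sum_pow c]
  have hc : ∑ a, c a = 1 + k / 2 := by
    simp [c, Fintype.sum_option, hk, div_eq_mul_inv]
  rw [hc, div_pow]
  simp [hk, add_comm]

/-- The word over `Option β` with letters given by `u` on `S` and `none` elsewhere. -/
def extend {β ι : Type} (S : Set ι) (u : S → β) (i : ι) : Option β :=
  open Classical in if h : i ∈ S then some (u ⟨i, h⟩) else none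

lemma extend_bijective (β ι : Type) :
    Function.Bijective fun p : Σ S : Set ι, (S → β) ↦ extend p.1 p.2 := by
  classical
  constructor
  · rintro ⟨S, u⟩ ⟨T, v⟩ h
    dsimp only at h
    have hST : S = T := by
      ext i
      have := congrFun h i
      by_cases h1 : i ∈ S <;> by_cases h2 : i ∈ T <;> simp_all [extend]
    subst hST
    congr 1
    ext i
    simpa [extend] using congrFun h i
  · intro x
    refine ⟨⟨{i | (x i).isSome}, fun i ↦ (x i).get i.2⟩, ?_⟩
    ext i
    cases h : x i <;> simp [extend, h]

lemma Insensitive.exists_subspace_of_extend {β ι η : Type} {r : β} {D : Set (ι → Option β)}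
    (hD : Insensitive r D) {S : Set ι} (V : Subspace η β S) (hV : ∀ z, extend S (V z) ∈ D) :
    ∃ W : Subspace η (Option β) ι, ∀ z, W z ∈ D := by
  classical
  refine ⟨⟨fun i ↦ if h : i ∈ S then (V.idxFun ⟨i, h⟩).map some id else .inl none, fun e ↦ ?_⟩,
    fun z ↦ ?_⟩
  · obtain ⟨i, hi⟩ := V.proper e
    exact ⟨i, by simp [hi]⟩
  · rw [← hD]
    convert (hD _).2 (hV fun e ↦ (z e).getD r) using 1
    ext i
    by_cases h : i ∈ S
    · rcases h' : V.idxFun ⟨i, h⟩ <;> simp [subst, Subspace.coe_apply, extend, h, h']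
    · simp [subst, Subspace.coe_apply, extend, h]

lemma DensityHJ.exists_subspace_of_insensitive {β : Type} [Finite β] [Nonempty β]
    (h : DensityHJ β) (d : ℕ) {η : ℝ} (hη : 0 < η) :
    ∃ (ι : Type) (_ : Finite ι), ∀ (r : β) (D : Set (ι → Option β)), Insensitive r D →
      η ≤ dens D → ∃ V : Subspace (Fin d) (Option β) ι, ∀ x, V x ∈ D := by
  classical
  cases nonempty_fintype β
  obtain ⟨N, hN⟩ := h.exists_subspace_of_le_card d (δ := η / 4) (by positivity)
  obtain ⟨n, hn⟩ := exists_dens_small_support β N (η := η / 4) (by positivity)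
  refine ⟨Fin n, inferInstance, fun r D hD hDη ↦ ?_⟩
  suffices ∃ S : Set (Fin n), N ≤ Nat.card S ∧ η / 4 ≤ dens {u : S → β | extend S u ∈ D} by
    obtain ⟨S, hS, hSD⟩ := this
    obtain ⟨V, hV⟩ := hN S hS _ hSD
    exact hD.exists_subspace_of_extend V hV
  by_contra! H
  let e := Equiv.ofBijective _ (extend_bijective β (Fin n))
  let small := {x : Fin n → Option β | Nat.card {i | x i ≠ none} < N}
  have key : dens D ≤ mean fun x ↦ η / 4 + small.indicator 1 x := by
    rw [dens, ← mean_comp_equiv e, ← mean_comp_equiv e fun x ↦ η / 4 + small.indicator 1 x,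
      mean_eq_sum_div, mean_eq_sum_div]
    gcongr ?_ / _
    rw [Fintype.sum_sigma, Fintype.sum_sigma]
    refine Finset.sum_le_sum fun S _ ↦ ?_
    by_cases hS : N ≤ Nat.card S
    · have h1 := H S hS
      rw [dens, mean_eq_sum_div, div_lt_iff₀ (by simp [Fintype.card_pos])] at h1
      calc _ ≤ ∑ u : S → β, η / 4 := by
            refine le_trans (le_of_eq ?_) (h1.le.trans_eq (by simp [mul_comm]))
            rfl
        _ ≤ _ := Finset.sum_le_sum fun u _ ↦ by
            have := indicator_one_nonneg small (e ⟨S, u⟩)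
            linarith
    · refine Finset.sum_le_sum fun u _ ↦ ?_
      have hmem : e ⟨S, u⟩ ∈ small := by
        have : {i | e ⟨S, u⟩ i ≠ none} = S := by
          ext i
          simp [e, extend]
        simp only [small, mem_ofPred_eq]
        rw [this]
        exact not_le.1 hS
      rw [indicator_of_mem hmem]
      have := indicator_one_le_one D (e ⟨S, u⟩)
      simp only [Pi.one_apply]
      linarith
  rw [mean_add, mean_const] at key
  change dens D ≤ _ + dens small at key
  linarith

/-! ### Functions with nonpositive averages on subspaces -/

/-- The function `g` has nonpositive average on every `d`-dimensional subspace. -/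
def SubspaceNonpos {α ι : Type} [Finite α] (d : ℕ) (g : (ι → α) → ℝ) : Prop :=
  ∀ V : Subspace (Fin d) α ι, mean (fun z ↦ g (V z)) ≤ 0

lemma mean_indicator_box {α ι κ : Type} [Finite α] [Finite ι] [Finite κ] (S : Set (ι → α))
    (B : Set (κ → α)) (g : (ι ⊕ κ → α) → ℝ) :
    mean ({z : ι ⊕ κ → α | z ∘ Sum.inl ∈ S ∧ z ∘ Sum.inr ∈ B}.indicator g) =
      mean (B.indicator fun y ↦ mean (S.indicator fun x ↦ g (Sum.elim x y))) := by
  classical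
  rw [mean_cube_sum']
  congr 1
  ext y
  by_cases hy : y ∈ B
  · rw [indicator_of_mem hy]
    congr 1
    ext x
    simp [indicator_apply, hy]
  · rw [indicator_of_notMem hy]
    simp [hy, mean]

/-- The part of a dense insensitive set that can be removed without decreasing the average. -/
lemma exists_removable {β ι κ : Type} [Finite β] [Finite ι] [Finite κ] {d : ℕ} {η : ℝ}
    (hη : 0 < η)
    (hι : ∀ (r : β) (D : Set (ι → Option β)), Insensitive r D → η / 2 ≤ dens D →
      ∃ V : Subspace (Fin d) (Option β) ι, ∀ x, V x ∈ D)
    {r : β} {D : Set (ι ⊕ κ → Option β)} (hD : Insensitive r D) (hDη : η ≤ dens D)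
    {g : (ι ⊕ κ → Option β) → ℝ} (hg : SubspaceNonpos d g) :
    ∃ R ⊆ D, (∀ x, Insensitive r {y | Sum.elim x y ∈ D \ R}) ∧ mean (R.indicator g) ≤ 0 ∧
      η / 2 / (Nat.card (Subspace (Fin d) (Option β) ι) + 1) / Nat.card (ι → Option β) ≤
        dens R := by
  have hD' : η ≤ mean fun y : κ → Option β ↦ dens {x : ι → Option β | Sum.elim x y ∈ D} := by
    rw [dens, mean_cube_sum'] at hDη
    exact hDη
  obtain ⟨V, hV⟩ := exists_popular hη
    (fun V : Subspace (Fin d) (Option β) ι ↦ range V) _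
    (fun y hy ↦ by
      simpa [range_subset_iff] using hι r _ (fun x ↦ hD.sum_elim_left x y) hy) hD'
  set B := {y : κ → Option β | range V ⊆ {x | Sum.elim x y ∈ D}} with hB
  have hBr : Insensitive r B := fun y ↦ by
    simp only [hB, range_subset_iff, mem_ofPred_eq, hD.sum_elim_right]
  refine ⟨{z | z ∘ Sum.inl ∈ range V ∧ z ∘ Sum.inr ∈ B}, ?_, fun x y ↦ ?_, ?_, ?_⟩
  · rintro z ⟨h1, h2⟩
    have := h2 h1
    rwa [mem_ofPred_eq, Sum.elim_comp_inl_inr] at this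
  · have h1 := hD.sum_elim_right x y
    have h2 := hBr y
    simp only [mem_ofPred_eq, Set.mem_sdiff, Sum.elim_comp_inl, Sum.elim_comp_inr, h1, h2]
  · rw [mean_indicator_box, ← neg_nonneg, ← neg_one_mul, ← mean_const_mul]
    refine mean_nonneg fun y ↦ ?_
    rw [neg_one_mul, neg_nonneg]
    refine indicator_nonpos (fun y _ ↦ ?_) y
    rw [mean_range_indicator (subspace_injective V)]
    have := hg (fiberLeft V y)
    simp only [fiberLeft_apply] at this
    exact mul_nonpos_of_nonneg_of_nonpos (by positivity) this
  · rw [dens, mean_indicator_box]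
    refine (div_le_div_of_nonneg_right hV (Nat.cast_nonneg _)).trans ?_
    rw [div_eq_inv_mul, dens, ← mean_const_mul]
    refine mean_mono fun y ↦ ?_
    by_cases hy : y ∈ B
    · rw [indicator_of_mem hy, indicator_of_mem hy, mean_range_indicator (subspace_injective V)]
      simp only [Pi.one_apply, mean_const, mul_one]
      rw [inv_eq_one_div]
      gcongr
      exact_mod_cast Nat.card_pos
    · rw [indicator_of_notMem hy, indicator_of_notMem hy, mul_zero]

lemma mean_indicator_le_of_dens {β : Type} [Finite β] {d : ℕ} {η : ℝ} (hη : 0 < η) {ι : Type}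
    [Finite ι] (hι : ∀ (r : β) (D : Set (ι → Option β)), Insensitive r D → η / 2 ≤ dens D →
      ∃ V : Subspace (Fin d) (Option β) ι, ∀ x, V x ∈ D) :
    ∃ c : ℝ, 0 < c ∧ c ≤ 1 ∧ ∀ t : ℕ, ∃ (κ : Type) (_ : Finite κ),
      ∀ (r : β) (D : Set (κ → Option β)), Insensitive r D → ∀ g : (κ → Option β) → ℝ,
        (∀ x, g x ≤ 1) → SubspaceNonpos d g →
          mean (D.indicator g) ≤ η + (1 - c) ^ t * (dens D - η) := by
  obtain ⟨c, hc⟩ : ∃ c : ℝ, c = min 1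
    (η / 2 / (Nat.card (Subspace (Fin d) (Option β) ι) + 1) / Nat.card (ι → Option β)) := ⟨_, rfl⟩
  have hc0 : 0 < c := by
    have : (0 : ℝ) < Nat.card (ι → Option β) := by exact_mod_cast Nat.card_pos
    rw [hc]
    positivity
  have hc1 : c ≤ 1 := hc ▸ min_le_left _ _
  refine ⟨c, hc0, hc1, fun t ↦ ?_⟩
  induction t with
  | zero =>
    refine ⟨Empty, inferInstance, fun r D hD g hg _ ↦ ?_⟩
    rw [pow_zero, one_mul, add_sub_cancel]
    exact mean_mono fun x ↦ indicator_le_indicator (hg x)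
  | succ t ih =>
    obtain ⟨κ, _, hκ⟩ := ih
    refine ⟨ι ⊕ κ, inferInstance, fun r D hD g hg hgd ↦ ?_⟩
    have hl : 0 ≤ (1 - c) ^ t := pow_nonneg (by linarith) t
    have key : ∀ E : Set (ι ⊕ κ → Option β), (∀ x, Insensitive r {y | Sum.elim x y ∈ E}) →
        mean (E.indicator g) ≤ η + (1 - c) ^ t * (dens E - η) := by
      intro E hE
      calc mean (E.indicator g) ≤ mean fun x : ι → Option β ↦
            η + (1 - c) ^ t * (dens {y : κ → Option β | Sum.elim x y ∈ E} - η) := by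
            rw [mean_cube_sum]
            refine mean_mono fun x ↦ hκ r _ (hE x) (fun y ↦ g (Sum.elim x y)) (fun y ↦ hg _) ?_
            intro V
            simpa only [fiberRight_apply] using hgd (fiberRight x V)
        _ = _ := by
            rw [mean_add, mean_const, mean_const_mul, mean_sub, mean_const, dens, mean_cube_sum]
            rfl
    rw [pow_succ, mul_assoc]
    by_cases hDη : η ≤ dens D
    · obtain ⟨R, hRD, hR, hRg, hRc⟩ := exists_removable hη hι hD hDη hgd
      have hcR : c ≤ dens R := hc ▸ (min_le_right _ _).trans hRc
      have hsplit : ∀ f : (ι ⊕ κ → Option β) → ℝ,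
          mean (D.indicator f) = mean ((D \ R).indicator f) + mean (R.indicator f) := by
        intro f
        rw [← mean_add]
        congr 1
        rw [← indicator_union_of_disjoint disjoint_sdiff_left, sdiff_union_of_subset hRD]
      have h1 := hsplit g
      have h2 : dens D = dens (D \ R) + dens R := hsplit 1
      have h3 := key _ hR
      have h4 : (1 - c) ^ t * (dens (D \ R) - η) ≤ (1 - c) ^ t * ((1 - c) * (dens D - η)) := by
        refine mul_le_mul_of_nonneg_left ?_ hl
        have := dens_le_one D
        nlinarith
      linarith
    · have h3 := key D fun x y ↦ hD.sum_elim_right x y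
      have h4 : (1 - c) ^ t * (dens D - η) ≤ (1 - c) ^ t * ((1 - c) * (dens D - η)) := by
        refine mul_le_mul_of_nonneg_left ?_ hl
        nlinarith
      linarith

lemma DensityHJ.mean_indicator_le {β : Type} [Finite β] [Nonempty β] (h : DensityHJ β) (d : ℕ)
    {η : ℝ} (hη : 0 < η) :
    ∃ m : ℕ, ∀ (r : β) (D : Set (Fin m → Option β)), Insensitive r D →
      ∀ g : (Fin m → Option β) → ℝ, (∀ x, g x ≤ 1) → SubspaceNonpos d g →
        mean (D.indicator g) ≤ η := by
  obtain ⟨ι, _, hι⟩ := h.exists_subspace_of_insensitive d (η := η / 2 / 2) (by positivity)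
  obtain ⟨c, hc0, hc1, hc⟩ := mean_indicator_le_of_dens (η := η / 2) (by positivity) hι
  have hlim := tendsto_pow_atTop_nhds_zero_of_lt_one (r := 1 - c) (by linarith) (by linarith)
  obtain ⟨t, ht⟩ := (hlim.eventually_le_const (half_pos hη)).exists
  obtain ⟨κ, _, hκ⟩ := hc t
  let e : κ ≃ Fin (Nat.card κ) := Finite.equivFin κ
  refine ⟨Nat.card κ, fun r D hD g hg hgd ↦ ?_⟩
  have := hκ r {x | x ∘ e.symm ∈ D} (fun x ↦ hD (x ∘ e.symm)) (fun x ↦ g (x ∘ e.symm))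
    (fun x ↦ hg _) (fun V ↦ ?_)
  · have h1 : mean (D.indicator g) =
        mean ({x : κ → Option β | x ∘ e.symm ∈ D}.indicator fun x ↦ g (x ∘ e.symm)) := by
      rw [← mean_comp_equiv (e.arrowCongr (Equiv.refl (Option β)))]
      rfl
    have h2 := dens_le_one {x : κ → Option β | x ∘ e.symm ∈ D}
    have h3 : 0 ≤ (1 - c) ^ t := pow_nonneg (by linarith) t
    nlinarith
  · convert hgd (V.reindex (Equiv.refl _) (Equiv.refl _) e) using 4 with z
    ext i
    simp

lemma SubspaceNonpos.comp {α ι : Type} [Finite α] {d : ℕ} {g : (ι → α) → ℝ} {n : ℕ}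
    (hg : SubspaceNonpos d g) (V : Subspace (Fin n) α ι) : SubspaceNonpos d fun z ↦ g (V z) := by
  intro U
  simpa only [comp_apply] using hg (DensityHalesJewett.comp V U)

lemma DensityHJ.mean_biInter_indicator_le {β : Type} [Finite β] [Nonempty β] (h : DensityHJ β)
    (s : Finset β) : ∀ (d : ℕ) {η : ℝ}, 0 < η →
      ∃ m : ℕ, ∀ E : β → Set (Fin m → Option β), (∀ r ∈ s, Insensitive r (E r)) →
        ∀ g : (Fin m → Option β) → ℝ, (∀ x, g x ≤ 1) → SubspaceNonpos d g →
          mean ((⋂ r ∈ s, E r).indicator g) ≤ η := by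
  classical
  induction s using Finset.induction_on with
  | empty =>
    refine fun d η hη ↦ ⟨d, fun E _ g _ hg ↦ ?_⟩
    simpa [default_apply] using (hg default).trans hη.le
  | insert r s hr ih =>
    intro d η hη
    obtain ⟨d', hd'⟩ := ih d (half_pos hη)
    obtain ⟨m, hm⟩ := h.mean_indicator_le d' (half_pos hη)
    refine ⟨m, fun E hE g hg hgd ↦ ?_⟩
    have h1 := hm r (E r) (hE r (Finset.mem_insert_self r s))
      (fun x ↦ (⋂ r ∈ s, E r).indicator g x - η / 2) (fun x ↦ ?_) (fun V ↦ ?_)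
    · have h2 : mean ((⋂ t ∈ insert r s, E t).indicator g) ≤
          mean fun x ↦
            (E r).indicator (fun x ↦ (⋂ r ∈ s, E r).indicator g x - η / 2) x + η / 2 := by
        refine mean_mono fun x ↦ ?_
        rw [Finset.set_biInter_insert, ← indicator_indicator]
        by_cases hx : x ∈ E r
        · simp [hx]
        · simp [hx, (half_pos hη).le]
      rw [mean_add, mean_const] at h2
      linarith
    · have : (⋂ r ∈ s, E r).indicator g x ≤ 1 :=
        indicator_le' (fun x _ ↦ hg x) (fun _ _ ↦ zero_le_one) x
      linarith
    · have := hd' (fun r ↦ V ⁻¹' E r)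
        (fun r hr ↦ (hE r (Finset.mem_insert_of_mem hr)).preimage V) (fun z ↦ g (V z))
        (fun z ↦ hg _) (hgd.comp V)
      rw [mean_sub, mean_const, sub_nonpos]
      convert this using 2
      ext z
      simp [indicator_apply]

/-- Functions with nonpositive averages on subspaces have small average on the complement of an
intersection of insensitive sets. -/
lemma DensityHJ.mean_compl_iInter_indicator_le {β : Type} [Finite β] [Nonempty β]
    (h : DensityHJ β) (d : ℕ) {η : ℝ} (hη : 0 < η) :
    ∃ m : ℕ, ∀ E : β → Set (Fin m → Option β), (∀ r, Insensitive r (E r)) →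
      ∀ g : (Fin m → Option β) → ℝ, (∀ x, g x ≤ 1) → SubspaceNonpos d g →
        mean ((⋂ r, E r)ᶜ.indicator g) ≤ Nat.card β * η := by
  classical
  cases nonempty_fintype β
  obtain ⟨m, hm⟩ := h.mean_biInter_indicator_le Finset.univ d hη
  refine ⟨m, fun E hE g hg hgd ↦ ?_⟩
  have key : ∀ s : Finset β, mean ((⋂ r ∈ s, E r)ᶜ.indicator g) ≤ s.card * η := by
    intro s
    induction s using Finset.induction_on with
    | empty => simp [mean]
    | insert r s hr ih =>
      have h1 := hm (fun t ↦ if t = r then (E t)ᶜ else if t ∈ s then E t else univ)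
        (fun t _ ↦ ?_) g hg hgd
      · have h2 : (⋂ t ∈ Finset.univ, if t = r then (E t)ᶜ else if t ∈ s then E t else univ) =
            (E r)ᶜ ∩ ⋂ t ∈ s, E t := by
          ext x
          simp only [Finset.mem_univ, iInter_true, mem_iInter, mem_inter_iff, mem_compl_iff]
          refine ⟨fun hx ↦ ⟨by simpa using hx r, fun t ht ↦ ?_⟩, fun hx t ↦ ?_⟩
          · have := hx t
            rwa [if_neg (ne_of_mem_of_not_mem ht hr), if_pos ht] at this
          · split_ifs with h3 h4
            · exact h3 ▸ hx.1
            · exact hx.2 t h4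
            · trivial
        rw [h2] at h1
        have h3 : (⋂ t ∈ insert r s, E t)ᶜ = (⋂ t ∈ s, E t)ᶜ ∪ ((E r)ᶜ ∩ ⋂ t ∈ s, E t) := by
          rw [Finset.set_biInter_insert]
          ext x
          simp only [mem_compl_iff, mem_inter_iff, mem_union]
          tauto
        have h4 : Disjoint (⋂ t ∈ s, E t)ᶜ ((E r)ᶜ ∩ ⋂ t ∈ s, E t) :=
          disjoint_compl_left.mono_right inter_subset_right
        rw [h3, indicator_union_of_disjoint h4, mean_add, Finset.card_insert_of_notMem hr]
        push_cast
        linarith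
      · split_ifs
        · exact (hE t).compl
        · exact hE t
        · exact fun x ↦ Iff.rfl
  simpa using key Finset.univ

/-! ### A Ramsey theorem for words with missing letters -/

section Lift

variable {β η ζ ι κ : Type*}

lemma lift_comp (V : Subspace η β ι) (U : Subspace ζ β η) (w : ζ → Option β) :
    lift (comp V U) w = lift V (lift U w) := by
  ext i : 1
  rcases h : V.idxFun i with b | e
  · simp [lift, comp, Subspace.coe_apply, h]
  · simp [lift, comp, Subspace.coe_apply, h]

lemma lift_prod_default (U : Subspace ζ β κ) (w : η ⊕ ζ → Option β) :
    lift (prod default U) w = Sum.elim (w ∘ Sum.inl) (lift U (w ∘ Sum.inr)) := by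
  ext i : 1
  rcases i with i | i
  · rfl
  · rcases h : U.idxFun i <;> simp [lift, prod, Subspace.coe_apply, h]

end Lift

/-- For every finite colouring there is a subspace over `β`, of dimension indexed by `P`, such
that each of its words over `Option β` in which `none` occurs has the colour of a
monochromatic `m`-dimensional subspace over `Option β`. -/
def HasMonoSubspaces (β P : Type) (m : ℕ) : Prop :=
  ∀ (κ : Type) [Finite κ], ∃ (ι : Type) (_ : Finite ι), ∀ χ : (ι → Option β) → κ,
    ∃ W : Subspace P β ι, ∀ w : P → Option β, (∃ i, w i = none) →
      ∃ V : Subspace (Fin m) (Option β) ι, ∀ z, χ (V z) = χ (lift W w)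

lemma HasMonoSubspaces.congr {β P Q : Type} {m : ℕ} (h : HasMonoSubspaces β P m) (e : P ≃ Q) :
    HasMonoSubspaces β Q m := by
  intro κ _
  obtain ⟨ι, hι, H⟩ := h κ
  refine ⟨ι, hι, fun χ ↦ ?_⟩
  obtain ⟨W, hW⟩ := H χ
  refine ⟨W.reindex e (Equiv.refl _) (Equiv.refl _), fun w ⟨i, hi⟩ ↦ ?_⟩
  obtain ⟨V, hV⟩ := hW (w ∘ e) ⟨e.symm i, by simpa using hi⟩
  refine ⟨V, fun z ↦ (hV z).trans ?_⟩
  congr 1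
  ext i : 1
  rcases h : W.idxFun i <;> simp [lift, Subspace.reindex, Subspace.coe_apply, h]

/-- Given a subspace over `Option β` and a filler letter, the subspace over `β` whose first
coordinate stands for the letter `none`. -/
def noneAsCoordinate {β ι κ ζ : Type} (b : β) (U : Subspace (ι ⊕ ζ) (Option β) κ) :
    Subspace (Unit ⊕ ι) β (Unit ⊕ κ) where
  idxFun := Sum.elim (fun u ↦ .inr (.inl u)) fun i ↦
    (U.idxFun i).elim (fun a ↦ a.elim (.inr (.inl ())) .inl)
      (Sum.elim (fun e ↦ .inr (.inr e)) fun _ ↦ .inl b)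
  proper e := by
    rcases e with u | e
    · exact ⟨.inl u, rfl⟩
    · obtain ⟨i, hi⟩ := U.proper (.inl e)
      exact ⟨.inr i, by simp [hi]⟩

lemma lift_noneAsCoordinate {β ι κ ζ : Type} (b : β) (U : Subspace (ι ⊕ ζ) (Option β) κ)
    (z : ι → Option β) :
    lift (noneAsCoordinate b U) (Sum.elim (fun _ ↦ none) z) =
      Sum.elim (fun _ ↦ none) (U (Sum.elim z fun _ ↦ some b)) := by
  ext i : 1
  rcases i with i | i
  · rfl
  · rcases h : U.idxFun i with (_ | a) | (e | e) <;>
      simp [lift, noneAsCoordinate, Subspace.coe_apply, h]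

lemma HasMonoSubspaces.unit_sum {β P : Type} [Finite β] [Nonempty β] {m : ℕ}
    (h : HasMonoSubspaces β P m) : HasMonoSubspaces β (Unit ⊕ P) m := by
  intro κ _
  obtain ⟨ι, _, hι⟩ := h (β → κ)
  obtain ⟨ζ, _, hζ⟩ := Subspace.exists_mono_in_high_dimension (Option β) κ (ι ⊕ Fin m)
  refine ⟨Unit ⊕ ζ, inferInstance, fun χ ↦ ?_⟩
  obtain ⟨U, c, hU⟩ := hζ fun z ↦ χ (Sum.elim (fun _ ↦ none) z)
  replace hU : ∀ x, χ (Sum.elim (fun _ ↦ none) (U x)) = c := hU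
  obtain ⟨b⟩ := ‹Nonempty β›
  obtain ⟨W, hW⟩ := hι fun z a ↦ χ (lift (noneAsCoordinate b U) (Sum.elim (fun _ ↦ some a) z))
  refine ⟨comp (noneAsCoordinate b U) (prod default W), fun w ⟨i, hi⟩ ↦ ?_⟩
  rw [lift_comp, lift_prod_default]
  cases h0 : w (.inl ()) with
  | none =>
    have h1 : w ∘ Sum.inl = fun _ ↦ none := funext fun _ ↦ h0
    refine ⟨fiberRight (fun _ ↦ none) (comp U (fiberRight (fun _ ↦ none) default)), fun z ↦ ?_⟩
    rw [fiberRight_apply, comp_apply, hU, h1, lift_noneAsCoordinate, hU]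
  | some a =>
    have h1 : w ∘ Sum.inl = fun _ ↦ some a := funext fun _ ↦ h0
    obtain ⟨V, hV⟩ := hW (w ∘ Sum.inr) (by
      rcases i with i | i
      · exact absurd (hi.symm.trans h0) (by simp)
      · exact ⟨i, hi⟩)
    refine ⟨comp (lift (noneAsCoordinate b U)) (fiberRight (fun _ ↦ some a) V), fun z ↦ ?_⟩
    rw [comp_apply, fiberRight_apply, h1]
    exact congrFun (hV z) a

lemma hasMonoSubspaces (β P : Type) [Finite β] [Nonempty β] [Finite P] (m : ℕ) :
    HasMonoSubspaces β P m := by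
  suffices ∀ p : ℕ, HasMonoSubspaces β (Fin p) m from (this _).congr (Finite.equivFin P).symm
  intro p
  induction p with
  | zero =>
    exact fun κ _ ↦ ⟨Empty, inferInstance, fun χ ↦
      ⟨⟨Empty.elim, fun e ↦ e.elim0⟩, fun w ⟨i, _⟩ ↦ i.elim0⟩⟩
  | succ p ih => exact ih.unit_sum.congr (Fintype.equivOfCardEq (by simp [add_comm]))

/-! ### The density increment -/

/-- The set `A` contains no combinatorial line. -/
def LineFree {α ι : Type} (A : Set (ι → α)) : Prop := ∀ V : Subspace Unit α ι, ∃ x, V x ∉ A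

section LineFree

variable {α ι κ η : Type}

lemma LineFree.preimage {A : Set (ι → α)} (hA : LineFree A) (V : Subspace η α ι) :
    LineFree (V ⁻¹' A) := fun U ↦ by
  obtain ⟨x, hx⟩ := hA (comp V U)
  exact ⟨x, by rwa [comp_apply] at hx⟩

lemma LineFree.sum_elim_left {A : Set (ι ⊕ κ → α)} (hA : LineFree A) (x : ι → α) :
    LineFree {y | Sum.elim x y ∈ A} := fun U ↦ by
  obtain ⟨z, hz⟩ := hA (fiberRight x U)
  exact ⟨z, by rwa [fiberRight_apply] at hz⟩

lemma LineFree.sum_elim_right {A : Set (ι ⊕ κ → α)} (hA : LineFree A) (y : κ → α) :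
    LineFree {x | Sum.elim x y ∈ A} := fun U ↦ by
  obtain ⟨z, hz⟩ := hA (fiberLeft U y)
  exact ⟨z, by rwa [fiberLeft_apply] at hz⟩

/-- The extremal density of line-free sets. -/
lemma exists_extremal_density [Finite α] (h : ¬ DensityHJ α) :
    ∃ δ : ℝ, 0 < δ ∧ δ ≤ 1 ∧
      (∀ ε : ℝ, 0 < ε → ∀ (ι : Type) [Finite ι], ∃ A : Set (ι → α), LineFree A ∧ δ - ε ≤ dens A) ∧
      ∀ ε : ℝ, 0 < ε → ∃ n : ℕ, ∀ A : Set (Fin n → α), LineFree A → dens A ≤ δ + ε := by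
  let S := {δ : ℝ | ∀ (ι : Type) [Finite ι], ∃ A : Set (ι → α), LineFree A ∧ δ ≤ dens A}
  have hS : ∀ δ ∈ S, δ ≤ 1 := fun δ hδ ↦ by
    obtain ⟨A, -, hA⟩ := hδ Unit
    exact hA.trans (dens_le_one A)
  obtain ⟨δ, hδ0, hδ⟩ : ∃ δ : ℝ, 0 < δ ∧ δ ∈ S := by
    unfold DensityHJ at h
    push Not at h
    obtain ⟨δ, hδ, H⟩ := h
    exact ⟨δ, hδ, fun ι hι ↦ let ⟨A, hA, hA'⟩ := H ι hι; ⟨A, hA', hA⟩⟩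
  refine ⟨sSup S, hδ0.trans_le (le_csSup ⟨1, hS⟩ hδ), csSup_le ⟨δ, hδ⟩ hS, fun ε hε ι _ ↦ ?_,
    fun ε hε ↦ ?_⟩
  · obtain ⟨s, hs, hs'⟩ := exists_lt_of_lt_csSup ⟨δ, hδ⟩ (sub_lt_self (sSup S) hε)
    obtain ⟨A, hA, hA'⟩ := hs ι
    exact ⟨A, hA, hs'.le.trans hA'⟩
  · have : sSup S + ε ∉ S := fun h ↦ by
      have := le_csSup ⟨1, hS⟩ h
      linarith
    simp only [S, mem_ofPred_eq] at this
    push Not at this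
    obtain ⟨ι, _, H⟩ := this
    let e : ι ≃ Fin (Nat.card ι) := Finite.equivFin ι
    refine ⟨Nat.card ι, fun A hA ↦ ?_⟩
    have h1 := (H {x | x ∘ e.symm ∈ A} fun U ↦ ?_).le
    · refine le_of_eq_of_le ?_ h1
      unfold dens
      rw [← mean_comp_equiv (e.arrowCongr (Equiv.refl α))]
      rfl
    · obtain ⟨z, hz⟩ := hA (U.reindex (Equiv.refl _) (Equiv.refl _) e)
      refine ⟨z, fun hz' ↦ hz ?_⟩
      have : U.reindex (Equiv.refl _) (Equiv.refl _) e z = U z ∘ e.symm := by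
        ext i
        simp
      rwa [this]

end LineFree

section Increment

variable {β ι κ : Type}

lemma LineFree.exists_subst_notMem {A : Set (ι → Option β)} (hA : LineFree A) {x : ι → Option β}
    (hx : x ∈ A) (h : ∃ i, x i = none) : ∃ r, subst r x ∉ A := by
  obtain ⟨i, hi⟩ := h
  obtain ⟨z, hz⟩ := hA ⟨fun i ↦ (x i).elim (.inr ()) fun b ↦ .inl (some b),
    fun u ↦ ⟨i, by simp [hi]⟩⟩
  cases hz0 : z () with
  | none =>
    refine absurd ?_ hz
    convert hx using 1
    ext i : 1
    cases h : x i <;> simp [Subspace.coe_apply, h, hz0]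
  | some r =>
    refine ⟨r, ?_⟩
    convert hz using 2
    ext i : 1
    cases h : x i <;> simp [Subspace.coe_apply, subst, h, hz0]

variable [Finite β]

/-- A line-free set over a subspace whose words all contain `none`: it is disjoint from an
intersection of insensitive sets, hence it is sparse. -/
lemma LineFree.dens_preimage_le {A : Set (ι → Option β)} (hA : LineFree A) {d m : ℕ} {δ η : ℝ}
    (hδ : 0 ≤ δ) (hd : ∀ B : Set (Fin d → Option β), LineFree B → dens B ≤ δ)
    (hm : ∀ E : β → Set (Fin m → Option β), (∀ r, Insensitive r (E r)) →
      ∀ g : (Fin m → Option β) → ℝ, (∀ x, g x ≤ 1) → SubspaceNonpos d g →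
        mean ((⋂ r, E r)ᶜ.indicator g) ≤ η)
    (V : Subspace (Fin m) (Option β) ι) (hV : ∀ z, ∃ i, V z i = none) :
    dens (V ⁻¹' A) ≤ η + δ * (1 - dens {z | ∀ r, subst r (V z) ∈ A}) := by
  have h1 := hm (fun r ↦ {z | subst r (V z) ∈ A})
    (fun r z ↦ by simp only [mem_ofPred_eq, subst_apply_subst])
    (fun z ↦ (V ⁻¹' A).indicator 1 z - δ)
    (fun z ↦ by linarith [indicator_one_le_one (V ⁻¹' A) z])
    (fun U ↦ by
      rw [mean_sub, mean_const, sub_nonpos]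
      exact hd _ ((hA.preimage V).preimage U))
  have h2 : (⋂ r, {z | subst r (V z) ∈ A}) = {z | ∀ r, subst r (V z) ∈ A} := by
    ext z
    simp
  rw [h2] at h1
  have h3 : ∀ z, ({z | ∀ r, subst r (V z) ∈ A}ᶜ.indicator
      fun z ↦ (V ⁻¹' A).indicator (1 : (Fin m → Option β) → ℝ) z - δ) z =
        (V ⁻¹' A).indicator (1 : (Fin m → Option β) → ℝ) z -
        δ * (1 - {z | ∀ r, subst r (V z) ∈ A}.indicator (1 : (Fin m → Option β) → ℝ) z) := by
    intro z
    by_cases hz : ∀ r, subst r (V z) ∈ A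
    · have hz1 : z ∈ {z | ∀ r, subst r (V z) ∈ A} := hz
      have hz2 : z ∉ V ⁻¹' A := fun h ↦ by
        obtain ⟨r, hr⟩ := hA.exists_subst_notMem h (hV z)
        exact hr (hz r)
      rw [indicator_of_notMem (not_not.2 hz1), indicator_of_notMem hz2, indicator_of_mem hz1]
      simp
    · have hz1 : z ∉ {z | ∀ r, subst r (V z) ∈ A} := hz
      rw [indicator_of_mem hz1, indicator_of_notMem hz1]
      ring
  rw [funext h3, mean_sub, mean_const_mul, mean_sub, mean_const] at h1
  simp only [dens]
  linarith

variable [Finite κ]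

/-- A subspace all of whose words contain `none` and can be completed in many ways. -/
lemma exists_good_subspace [Nonempty β] {P : Type} [Finite P] {m : ℕ} {δ θ : ℝ} (hδ : 0 < δ)
    (hP : ∀ A : Set (P → β), δ / 2 ≤ dens A → ∃ V : Subspace Unit β P, ∀ x, V x ∈ A)
    (hθ : θ = δ / 2 / (Nat.card (Subspace Unit β P) + 1))
    (hι : ∀ χ : (ι → Option β) → Prop × Prop, ∃ W : Subspace P β ι,
      ∀ w : P → Option β, (∃ i, w i = none) →
        ∃ V : Subspace (Fin m) (Option β) ι, ∀ z, χ (V z) = χ (lift W w))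
    (A : Set (ι ⊕ κ → Option β)) (hA : ∀ x, δ ≤ dens {y | Sum.elim x y ∈ A}) :
    ∃ V : Subspace (Fin m) (Option β) ι, ∀ z, (∃ i, V z i = none) ∧
      θ ≤ dens {y | ∀ r, Sum.elim (subst r (V z)) y ∈ A} := by
  obtain ⟨W, hW⟩ := hι fun x ↦
    (θ ≤ dens {y | ∀ r, Sum.elim (subst r x) y ∈ A}, ∃ i, x i = none)
  obtain ⟨l, hl⟩ := exists_popular hδ (fun l : Subspace Unit β P ↦ range l)
    (fun y : κ → Option β ↦ {a : P → β | Sum.elim (fun i ↦ some (W a i)) y ∈ A})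
    (fun y hy ↦ by simpa only [range_subset_iff] using hP _ hy) (by
      change δ ≤ mean fun y ↦ mean fun a ↦ _
      rw [mean_comm]
      exact le_mean fun a ↦ hA fun i ↦ some (W a i))
  obtain ⟨e, he⟩ := l.proper ()
  have hw : lift l (fun _ ↦ none) e = none := by simp [lift, Subspace.coe_apply, he]
  obtain ⟨V, hV⟩ := hW (lift l fun _ ↦ none) ⟨e, hw⟩
  refine ⟨V, fun z ↦ ?_⟩
  have h1 := hV z
  rw [Prod.mk.injEq, eq_iff_iff, eq_iff_iff] at h1
  refine ⟨h1.2.2 ?_, h1.1.2 ?_⟩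
  · obtain ⟨i, hi⟩ := W.proper e
    exact ⟨i, by
      rw [Subspace.coe_apply]
      change ((W.idxFun i).map some id).elim id _ = none
      rw [hi]
      exact hw⟩
  · rw [hθ]
    refine hl.trans (mean_mono fun y ↦ indicator_le_indicator_of_subset ?_
      (fun _ ↦ zero_le_one) y)
    intro y hy r
    have h2 := hy (mem_range_self fun _ ↦ r)
    rw [mem_ofPred_eq, ← lift_some, ← lift_some] at h2
    rwa [subst_lift, subst_lift]

lemma DensityHJ.option [Nonempty β] (h : DensityHJ β) : DensityHJ (Option β) := by
  by_contra hn
  obtain ⟨δ, hδ, hδ1, hlow, hhigh⟩ := exists_extremal_density hn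
  obtain ⟨P, _, hP⟩ := h (δ / 2 / 2) (by positivity)
  obtain ⟨θ, hθ⟩ : ∃ θ : ℝ, θ = δ / 2 / 2 / (Nat.card (Subspace Unit β P) + 1) := ⟨_, rfl⟩
  have hθ0 : 0 < θ := hθ ▸ by positivity
  have hθ1 : θ ≤ 1 := by
    rw [hθ, div_le_one (by positivity)]
    have : (0 : ℝ) ≤ Nat.card (Subspace Unit β P) := Nat.cast_nonneg _
    linarith
  have hε : 0 < δ * θ / 8 := by positivity
  have hεδ : δ * θ / 8 ≤ δ / 2 := by nlinarith
  obtain ⟨d, hd⟩ := hhigh _ hε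
  have hk : (0 : ℝ) < Nat.card β := by exact_mod_cast Nat.card_pos
  obtain ⟨m, hm⟩ := h.mean_compl_iInter_indicator_le d (η := δ * θ / 4 / Nat.card β)
    (by positivity)
  rw [mul_div_cancel₀ _ hk.ne'] at hm
  obtain ⟨ι, _, hι⟩ := hasMonoSubspaces β P m (Prop × Prop)
  have hN : (0 : ℝ) < Nat.card (ι → Option β) := by exact_mod_cast Nat.card_pos
  obtain ⟨ε, hε'⟩ : ∃ ε : ℝ, ε = δ * θ / 8 / (2 * Nat.card (ι → Option β)) := ⟨_, rfl⟩
  have hε0 : 0 < ε := hε' ▸ by positivity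
  obtain ⟨n, hn⟩ := hhigh ε hε0
  obtain ⟨A, hA, hAδ⟩ := hlow ε hε0 (ι ⊕ Fin n)
  have hfib : ∀ x, δ - δ * θ / 8 ≤ dens {y | Sum.elim x y ∈ A} := by
    intro x
    have h1 := le_card_mul_mean
      (f := fun x : ι → Option β ↦ δ + ε - dens {y : Fin n → Option β | Sum.elim x y ∈ A})
      (fun x ↦ sub_nonneg.2 (hn _ (hA.sum_elim_left x))) x
    rw [mean_sub, mean_const] at h1
    have h2 : (mean fun x : ι → Option β ↦ dens {y : Fin n → Option β | Sum.elim x y ∈ A}) =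
      dens A := by
      rw [dens, mean_cube_sum]
      rfl
    rw [h2] at h1
    have h3 : Nat.card (ι → Option β) * (δ + ε - dens A) ≤
        Nat.card (ι → Option β) * (2 * ε) :=
      mul_le_mul_of_nonneg_left (by linarith) hN.le
    have h4 : Nat.card (ι → Option β) * (2 * ε) = δ * θ / 8 := by
      rw [hε']
      field_simp
    linarith
  obtain ⟨V, hV⟩ := exists_good_subspace (half_pos hδ) hP hθ hι A
    fun x ↦ le_trans (by linarith) (hfib x)
  have h1 : (mean fun y : Fin n → Option β ↦ dens (V ⁻¹' {x | Sum.elim x y ∈ A})) ≤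
      mean fun y ↦ δ * θ / 4 + (δ + δ * θ / 8) *
        (1 - dens {z | ∀ r, subst r (V z) ∈ {x | Sum.elim x y ∈ A}}) :=
    mean_mono fun y ↦ (hA.sum_elim_right y).dens_preimage_le (by positivity) hd hm V
      fun z ↦ (hV z).1
  rw [mean_add, mean_const, mean_const_mul, mean_sub, mean_const] at h1
  have h2 : δ - δ * θ / 8 ≤
      mean fun y : Fin n → Option β ↦ dens (V ⁻¹' {x | Sum.elim x y ∈ A}) := by
    simp only [dens]
    rw [mean_comm]
    exact le_mean fun z ↦ hfib (V z)
  have h3 : θ ≤ mean fun y : Fin n → Option β ↦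
      dens {z | ∀ r, subst r (V z) ∈ {x | Sum.elim x y ∈ A}} := by
    simp only [dens]
    rw [mean_comm]
    exact le_mean fun z ↦ (hV z).2
  nlinarith [mul_pos hδ hθ0]

end Increment

/-! ### The density Hales-Jewett theorem -/

lemma DensityHJ.congr {α β : Type} [Finite α] [Finite β] (e : α ≃ β) (h : DensityHJ α) :
    DensityHJ β := by
  intro δ hδ
  obtain ⟨ι, hι, H⟩ := h δ hδ
  refine ⟨ι, hι, fun A hA ↦ ?_⟩
  obtain ⟨V, hV⟩ := H {x | e ∘ x ∈ A} (by
    rw [dens, ← mean_comp_equiv ((Equiv.refl ι).arrowCongr e)] at hA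
    exact hA)
  refine ⟨V.reindex (Equiv.refl _) e (Equiv.refl _), fun x ↦ ?_⟩
  have h1 := hV (e.symm ∘ x)
  have h2 : V.reindex (Equiv.refl _) e (Equiv.refl _) x = e ∘ V (e.symm ∘ x) := by
    ext i
    simp
  rwa [h2]

lemma densityHJ_of_subsingleton {β : Type} [Finite β] [Subsingleton β] : DensityHJ β := by
  refine fun δ hδ ↦ ⟨Unit, inferInstance, fun A hA ↦ ?_⟩
  obtain ⟨x, hx⟩ := exists_mem_of_dens_pos hδ hA
  exact ⟨default, fun y ↦ by rwa [Subsingleton.elim ((default : Subspace Unit β Unit) y) x]⟩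

/-- The density Hales-Jewett theorem. -/
theorem densityHJ (β : Type) [Finite β] : DensityHJ β := by
  suffices ∀ k : ℕ, DensityHJ (Fin k) from (this _).congr (Finite.equivFin β).symm
  intro k
  induction k with
  | zero => exact densityHJ_of_subsingleton
  | succ k ih =>
    cases k with
    | zero => exact densityHJ_of_subsingleton (β := Fin 1)
    | succ k => exact ih.option.congr (finSuccEquiv (k + 1)).symm

/-! ### Sets of positive density in a group -/

lemma exists_dens_translates {Γ W : Type*} [Group Γ] [DecidableEq Γ] [Finite W] [Nonempty W]
    {F : Finset Γ} (hF : F.Nonempty) (Λ : Set Γ) [DecidablePred (· ∈ Λ)] {δ : ℝ} (hδ : 0 < δ)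
    (hΛ : δ ≤ (F.filter (· ∈ Λ)).card / F.card) (s : W → Γ)
    (hs : ∀ w, (symmDiff (F.image (fun x ↦ s w * x)) F).card / (F.card : ℝ) ≤ δ / 2) :
    ∃ x, δ / 2 ≤ dens {w | s w * x ∈ Λ} := by
  have hF0 : (0 : ℝ) < F.card := by exact_mod_cast hF.card_pos
  have h1 : ∀ w, δ / 2 ≤ mean fun x : F ↦ {w | s w * x ∈ Λ}.indicator (1 : W → ℝ) w := by
    intro w
    have h2 : F.filter (· ∈ Λ) ⊆ (F.filter fun x ↦ s w * x ∈ Λ).image (fun x ↦ s w * x) ∪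
        symmDiff (F.image (fun x ↦ s w * x)) F := by
      intro y hy
      rw [Finset.mem_filter] at hy
      by_cases h : y ∈ F.image fun x ↦ s w * x
      · obtain ⟨x, hx, rfl⟩ := Finset.mem_image.1 h
        exact Finset.mem_union_left _
          (Finset.mem_image_of_mem _ (Finset.mem_filter.2 ⟨hx, hy.2⟩))
      · exact Finset.mem_union_right _ (Finset.mem_symmDiff.2 (.inr ⟨hy.1, h⟩))
    have h3 : ((F.filter (· ∈ Λ)).card : ℝ) ≤ (F.filter fun x ↦ s w * x ∈ Λ).card +
        (symmDiff (F.image (fun x ↦ s w * x)) F).card := by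
      exact_mod_cast (Finset.card_le_card h2).trans
        ((Finset.card_union_le _ _).trans (Nat.add_le_add_right Finset.card_image_le _))
    have h4 : (∑ x : F, {w | s w * x ∈ Λ}.indicator (1 : W → ℝ) w) =
        (F.filter fun x ↦ s w * x ∈ Λ).card := by
      rw [F.sum_coe_sort fun x ↦ {w | s w * x ∈ Λ}.indicator (1 : W → ℝ) w,
        Finset.card_filter]
      push_cast
      exact Finset.sum_congr rfl fun x _ ↦ by simp [indicator_apply]
    have h5 := hs w
    rw [mean_eq_sum_div, h4, Fintype.card_coe, le_div_iff₀ hF0]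
    rw [le_div_iff₀ hF0] at hΛ
    rw [div_le_iff₀ hF0] at h5
    linarith
  have h6 : δ / 2 ≤ mean fun x : F ↦ dens {w | s w * x ∈ Λ} := by
    simp only [dens]
    rw [mean_comm]
    exact le_mean h1
  obtain ⟨x, hx⟩ := exists_le_of_le_mean (half_pos hδ) h6
  exact ⟨x, hx⟩

/-- The coordinate sums of the points of a combinatorial line form an arithmetic progression. -/
lemma exists_sum_line_eq {k : ℕ} {ι : Type*} [Fintype ι] (V : Subspace Unit (Fin k) ι) :
    ∃ c n : ℕ, 0 < n ∧ ∀ j : Fin k, ∑ i, (V (fun _ ↦ j) i : ℕ) = c + j * n := by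
  classical
  refine ⟨∑ i, (V.idxFun i).elim (fun a : Fin k ↦ (a : ℕ)) fun _ ↦ 0,
    ∑ i, (V.idxFun i).elim (fun _ ↦ 0) fun _ ↦ 1, ?_, fun j ↦ ?_⟩
  · obtain ⟨i, hi⟩ := V.proper ()
    refine Finset.sum_pos' (fun _ _ ↦ Nat.zero_le _) ⟨i, Finset.mem_univ i, ?_⟩
    simp [hi]
  · rw [Finset.mul_sum, ← Finset.sum_add_distrib]
    refine Finset.sum_congr rfl fun i _ ↦ ?_
    rcases h : V.idxFun i <;> simp [Subspace.coe_apply, h]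


end

end DensityHalesJewett

/-- In a countable amenable group `Γ` containing an element `b` of infinite order, a set
`Λ` with positive upper density with respect to a left Følner sequence contains, for every
`k`, a left arithmetic progression `{b^(j n) * a : j = 1, …, k}` of `k` distinct elements. -/
theorem stmt11 {Γ : Type*} [Group Γ] [Countable Γ] [DecidableEq Γ]
    (F : ℕ → Finset Γ) (hF : ∀ n, (F n).Nonempty)
    (hFolner : ∀ s : Γ,
      Tendsto
        (fun n => ((symmDiff ((F n).image (fun x => s * x)) (F n)).card : ℝ) / ((F n).card : ℝ))
        atTop (𝓝 0))
    (b : Γ) (hb : ¬ IsOfFinOrder b)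
    (Λ : Set Γ) [DecidablePred (· ∈ Λ)]
    (hΛ : 0 < Filter.limsup (fun n => (((F n).filter (· ∈ Λ)).card : ℝ) / ((F n).card : ℝ)) atTop)
    (k : ℕ) :
    ∃ a : Γ, ∃ n : ℕ, 0 < n ∧ (∀ j, 1 ≤ j → j ≤ k → b ^ (j * n) * a ∈ Λ) ∧
      ∀ i j, 1 ≤ i → i ≤ k → 1 ≤ j → j ≤ k → b ^ (i * n) * a = b ^ (j * n) * a → i = j := by
  classical
  rcases Nat.eq_zero_or_pos k with rfl | hk
  · exact ⟨1, 1, one_pos, fun j h1 h2 ↦ by omega, fun i j h1 h2 ↦ by omega⟩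
  have : Nonempty (Fin k) := ⟨⟨0, hk⟩⟩
  obtain ⟨δ, hδ, hδΛ⟩ := exists_between hΛ
  obtain ⟨ι, _, hι⟩ := DensityHalesJewett.densityHJ (Fin k) (δ / 2) (half_pos hδ)
  cases nonempty_fintype ι
  have hfreq := frequently_lt_of_lt_limsup
    (isCoboundedUnder_le_of_le atTop (x := 0) fun n ↦ by positivity) hδΛ
  have hev : ∀ᶠ n in atTop, ∀ w : ι → Fin k,
      ((symmDiff ((F n).image (fun x ↦ b ^ (∑ i, (w i : ℕ)) * x)) (F n)).card : ℝ) /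
        ((F n).card : ℝ) ≤ δ / 2 :=
    eventually_all.2 fun w ↦ (hFolner _).eventually_le_const (half_pos hδ)
  obtain ⟨N, hN, hN'⟩ := (hfreq.and_eventually hev).exists
  obtain ⟨x, hx⟩ := DensityHalesJewett.exists_dens_translates (hF N) Λ hδ hN.le
    (fun w : ι → Fin k ↦ b ^ (∑ i, (w i : ℕ))) hN'
  obtain ⟨V, hV⟩ := hι _ hx
  obtain ⟨c, n, hn, hsum⟩ := DensityHalesJewett.exists_sum_line_eq V
  refine ⟨(b ^ n)⁻¹ * (b ^ c * x), n, hn, fun j h1 hjk ↦ ?_, fun i j _ _ _ _ hij ↦ ?_⟩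
  · obtain ⟨j, rfl⟩ := Nat.exists_eq_add_of_le' h1
    have h2 : b ^ (∑ i, (V (fun _ ↦ ⟨j, hjk⟩) i : ℕ)) * x ∈ Λ := hV _
    rw [hsum] at h2
    convert h2 using 1
    rw [add_mul, one_mul, pow_add, add_comm c, pow_add]
    group
  · have h3 := injective_pow_iff_not_isOfFinOrder.2 hb (mul_right_cancel hij)
    exact Nat.eq_of_mul_eq_mul_right hn h3
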